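/- arXiv:2603.03628 — 3 statements merged into one kernel-verified Lean document; each statement's English description precedes it below -/
import Mathlib

section
/- In F = ℚ(A,q) the SO(N+1) quantum dimensions attached to Young diagrams with at most four boxes satisfy the plethysm (sum rule) identity d₍₁₎⁴ = d₍₄₎ + 3·d₍₃₁₎ + 2·d₍₂₂₎ + 3·d₍₂₁₁₎ + d₍₁₁₁₁₎ + 6·d₍₂₎ + 6·d₍₁₁₎ + 3. -/
/- STATEMENT 2: In F = ℚ(A,q) the SO(N+1) quantum dimensions attached to Young diagrams
with at most four boxes satisfy the plethysm identity
d₍₁₎⁴ = d₍₄₎ + 3·d₍₃₁₎ + 2·d₍₂₂₎ + 3·d₍₂₁₁₎ + d₍₁₁₁₁₎ + 6·d₍₂₎ + 6·d₍₁₁₎ + 3. -/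

noncomputable section

open MvPolynomial

/-- The field `ℚ(A, q)` of rational functions in two variables over `ℚ`. -/
abbrev F : Type := FractionRing (MvPolynomial (Fin 2) ℚ)

/-- The variable `A` in `ℚ(A, q)`. -/
def A : F := algebraMap (MvPolynomial (Fin 2) ℚ) F (X 0)

/-- The variable `q` in `ℚ(A, q)`. -/
def q : F := algebraMap (MvPolynomial (Fin 2) ℚ) F (X 1)

/-- The quantum bracket `{x} = x - x⁻¹`. -/
def br (x : F) : F := x - x⁻¹

def d₁ : F := 1 + br A / br q

def S₂ : F := br A * br (A * q) / (br q * br (q ^ 2))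

def S₁₁ : F := br A * br (A * q⁻¹) / (br q * br (q ^ 2))

def d₂ : F := (1 + br (q ^ 2) / br (A * q)) * S₂

def d₁₁ : F := (1 + br (q ^ 2) / br (A * q⁻¹)) * S₁₁

def S₄ : F :=
  br A * br (A * q) * br (A * q ^ 2) * br (A * q ^ 3) /
    (br q * br (q ^ 2) * br (q ^ 3) * br (q ^ 4))

def S₃₁ : F :=
  br A * br (A * q) * br (A * q ^ 2) * br (A * q⁻¹) /
    (br q ^ 2 * br (q ^ 2) * br (q ^ 4))

def S₂₁₁ : F :=
  br A * br (A * q) * br (A * q⁻¹) * br (A * (q ^ 2)⁻¹) /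
    (br q ^ 2 * br (q ^ 2) * br (q ^ 4))

def S₁₁₁₁ : F :=
  br A * br (A * q⁻¹) * br (A * (q ^ 2)⁻¹) * br (A * (q ^ 3)⁻¹) /
    (br q * br (q ^ 2) * br (q ^ 3) * br (q ^ 4))

def d₄ : F := (1 + br (q ^ 4) / br (A * q ^ 3)) * S₄

def d₃₁ : F := (1 + br (q ^ 4) / br (A * q)) * S₃₁

def d₂₂ : F :=
  (br (A * q ^ 2) * br (A * (q ^ 2)⁻¹) / (br q * br (q ^ 2) ^ 2 * br (q ^ 3))) *
    (A + q) * (1 - (A * q)⁻¹) * (A + q ^ 3) * (1 - A⁻¹ * (q ^ 3)⁻¹)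

def d₂₁₁ : F := (1 + br (q ^ 4) / br (A * q⁻¹)) * S₂₁₁

def d₁₁₁₁ : F := (1 + br (q ^ 4) / br (A * (q ^ 3)⁻¹)) * S₁₁₁₁

theorem algebraMap_ne_zero_of_eval_ne_zero {σ : Type*} (v : σ → ℚ) {p : MvPolynomial σ ℚ}
    (h : eval v p ≠ 0) : algebraMap (MvPolynomial σ ℚ) (FractionRing (MvPolynomial σ ℚ)) p ≠ 0 := by
  rw [Ne, map_eq_zero_iff _ (IsFractionRing.injective (MvPolynomial σ ℚ) _)]
  rintro rfl
  simp at h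

theorem A_ne_zero : A ≠ 0 :=
  algebraMap_ne_zero_of_eval_ne_zero (fun _ => 1) (by simp)

theorem q_ne_zero : q ≠ 0 :=
  algebraMap_ne_zero_of_eval_ne_zero (fun _ => 1) (by simp)

theorem q_sq_sub_one_ne_zero : q ^ 2 - 1 ≠ 0 := by
  have := algebraMap_ne_zero_of_eval_ne_zero ![0, 2] (p := X 1 ^ 2 - 1) (by norm_num)
  simpa [q] using this

theorem q_sq_add_one_ne_zero : q ^ 2 + 1 ≠ 0 := by
  have := algebraMap_ne_zero_of_eval_ne_zero ![0, 2] (p := X 1 ^ 2 + 1) (by norm_num)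
  simpa [q] using this

theorem q_pow_four_add_q_sq_add_one_ne_zero : q ^ 4 + q ^ 2 + 1 ≠ 0 := by
  have := algebraMap_ne_zero_of_eval_ne_zero ![0, 2] (p := X 1 ^ 4 + X 1 ^ 2 + 1) (by norm_num)
  simpa [q] using this

theorem q_pow_four_add_one_ne_zero : q ^ 4 + 1 ≠ 0 := by
  have := algebraMap_ne_zero_of_eval_ne_zero ![0, 2] (p := X 1 ^ 4 + 1) (by norm_num)
  simpa [q] using this

theorem br_eq {x : F} (hx : x ≠ 0) : br x = (x ^ 2 - 1) / x := by
  rw [br]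
  field_simp

theorem br_A_mul_pow_ne_zero (n : ℕ) : br (A * q ^ n) ≠ 0 := by
  have h : (A * q ^ n) ^ 2 - 1 ≠ 0 := by
    have := algebraMap_ne_zero_of_eval_ne_zero ![0, 2] (p := (X 0 * X 1 ^ n) ^ 2 - 1) (by norm_num)
    simpa [A, q] using this
  have hx : A * q ^ n ≠ 0 := mul_ne_zero A_ne_zero (pow_ne_zero n q_ne_zero)
  rw [br_eq hx]
  exact div_ne_zero h hx

theorem br_A_mul_inv_pow_ne_zero (n : ℕ) : br (A * (q ^ n)⁻¹) ≠ 0 := by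
  have h : A ^ 2 - (q ^ n) ^ 2 ≠ 0 := by
    have := algebraMap_ne_zero_of_eval_ne_zero ![0, 2] (p := X 0 ^ 2 - (X 1 ^ n) ^ 2) (by norm_num)
    simpa [A, q] using this
  have hA := A_ne_zero
  have hq := pow_ne_zero n q_ne_zero
  have e : br (A * (q ^ n)⁻¹) = (A ^ 2 - (q ^ n) ^ 2) / (A * q ^ n) := by
    rw [br]
    field_simp
  rw [e]
  exact div_ne_zero h (mul_ne_zero hA hq)

theorem plethysm_four_boxes :
    d₁ ^ 4 = d₄ + 3 * d₃₁ + 2 * d₂₂ + 3 * d₂₁₁ + d₁₁₁₁ + 6 * d₂ + 6 * d₁₁ + 3 := by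
  have h1 : br (A * q) ≠ 0 := by simpa using br_A_mul_pow_ne_zero 1
  have h1' : br (A * q⁻¹) ≠ 0 := by simpa using br_A_mul_inv_pow_ne_zero 1
  have h3 := br_A_mul_pow_ne_zero 3
  have h3' := br_A_mul_inv_pow_ne_zero 3
  have hA := A_ne_zero
  have hq := q_ne_zero
  have u := q_sq_sub_one_ne_zero
  have v := q_sq_add_one_ne_zero
  have w := q_pow_four_add_q_sq_add_one_ne_zero
  have w' : q ^ 2 * (q ^ 2 + 1) + 1 ≠ 0 := by
    convert w using 1; ring
  have z := q_pow_four_add_one_ne_zero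
  have b1 : br q = (q ^ 2 - 1) / q := br_eq hq
  have b2 : br (q ^ 2) = (q ^ 2 - 1) * (q ^ 2 + 1) / q ^ 2 := by
    rw [br_eq (pow_ne_zero 2 hq)]; ring
  have b3 : br (q ^ 3) = (q ^ 2 - 1) * (q ^ 4 + q ^ 2 + 1) / q ^ 3 := by
    rw [br_eq (pow_ne_zero 3 hq)]; ring
  have b4 : br (q ^ 4) = (q ^ 2 - 1) * (q ^ 2 + 1) * (q ^ 4 + 1) / q ^ 4 := by
    rw [br_eq (pow_ne_zero 4 hq)]; ring
  have e2 : d₂ = (br (A * q) + br (q ^ 2)) * br A / (br q * br (q ^ 2)) := by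
    rw [d₂, S₂, one_add_div h1]; field_simp
  have e11 : d₁₁ = (br (A * q⁻¹) + br (q ^ 2)) * br A / (br q * br (q ^ 2)) := by
    rw [d₁₁, S₁₁, one_add_div h1']
    generalize br (A * q⁻¹) = y at h1' ⊢
    field_simp
  have e4 : d₄ = (br (A * q ^ 3) + br (q ^ 4)) * br A * br (A * q) * br (A * q ^ 2) /
      (br q * br (q ^ 2) * br (q ^ 3) * br (q ^ 4)) := by
    rw [d₄, S₄, one_add_div h3]; field_simp
  have e31 : d₃₁ = (br (A * q) + br (q ^ 4)) * br A * br (A * q ^ 2) * br (A * q⁻¹) /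
      (br q ^ 2 * br (q ^ 2) * br (q ^ 4)) := by
    rw [d₃₁, S₃₁, one_add_div h1]; field_simp
  have e211 : d₂₁₁ = (br (A * q⁻¹) + br (q ^ 4)) * br A * br (A * q) * br (A * (q ^ 2)⁻¹) /
      (br q ^ 2 * br (q ^ 2) * br (q ^ 4)) := by
    rw [d₂₁₁, S₂₁₁, one_add_div h1']
    generalize br (A * q⁻¹) = y at h1' ⊢
    field_simp
  have e1111 : d₁₁₁₁ = (br (A * (q ^ 3)⁻¹) + br (q ^ 4)) * br A * br (A * q⁻¹) *
      br (A * (q ^ 2)⁻¹) / (br q * br (q ^ 2) * br (q ^ 3) * br (q ^ 4)) := by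
    rw [d₁₁₁₁, S₁₁₁₁, one_add_div h3']
    generalize br (A * (q ^ 3)⁻¹) = y at h3' ⊢
    field_simp
  rw [e2, e11, e4, e31, e211, e1111, d₁, d₂₂, b1, b2, b3, b4]
  clear e2 e11 e4 e31 e211 e1111 b1 b2 b3 b4 h1 h1' h3 h3'
  simp only [br]
  generalize A = a at *
  generalize q = x at *
  field_simp
  ring

end
end

section
/- The full twist on 4 strands F₄ := (σ₃σ₂σ₁)⁴ is represented by scalar matrices in the BMW representations: for every natural number k, ( ρ(σ₃)·ρ(σ₂)·ρ(σ₁) )^{4k} = (αβ)^{−2k}·I₆ in the 6-dimensional Birman–Wenzl representation, and, in the 3-dimensional representation ρ₀ (which sends σ₃ to ρ₀(σ₁)), ( ρ₀(σ₁)·ρ₀(σ₂)·ρ₀(σ₁) )² = α^{−2}·I₃, and consequently ( ρ₀(σ₁)·ρ₀(σ₂)·ρ₀(σ₁) )^{4k} = α^{−4k}·I₃. -/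
/- STATEMENT 16: The full twist F₄ = (σ₃σ₂σ₁)⁴ is represented by scalar matrices:
(ρ(σ₃)ρ(σ₂)ρ(σ₁))^{4k} = (αβ)^{−2k}·I₆ in the 6-dimensional Birman–Wenzl representation,
(ρ₀(σ₁)ρ₀(σ₂)ρ₀(σ₁))² = α^{−2}·I₃, and (ρ₀(σ₁)ρ₀(σ₂)ρ₀(σ₁))^{4k} = α^{−4k}·I₃. -/

open Matrix

noncomputable def ρσ₁ {F : Type*} [Field F] (α β : F) : Matrix (Fin 6) (Fin 6) F :=
  !![β⁻¹, 0, 0, 0, 0, 0;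
     0, 0, 0, 0, -1, 0;
     0, 0, 0, 0, 0, -1;
     0, 0, 0, α⁻¹, α⁻¹ * (β + β⁻¹), α⁻¹ * β * (β + β⁻¹);
     0, 1, 0, 0, β + β⁻¹, 0;
     0, 0, 1, 0, 0, β + β⁻¹]

noncomputable def ρσ₂ {F : Type*} [Field F] (α β : F) : Matrix (Fin 6) (Fin 6) F :=
  !![0, 0, -1, 0, 0, 0;
     0, α⁻¹, α⁻¹ * (β + β⁻¹), β + β⁻¹, 0, 0;
     1, 0, β + β⁻¹, 0, 0, 0;
     0, 0, 0, β + β⁻¹, 1, 0;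
     0, 0, 0, -1, 0, 0;
     0, 0, 0, 0, 0, β⁻¹]

noncomputable def ρσ₃ {F : Type*} [Field F] (α β : F) : Matrix (Fin 6) (Fin 6) F :=
  !![α⁻¹, β + β⁻¹, 0, 0, β⁻¹ * (β + β⁻¹), 0;
     0, β + β⁻¹, 1, 0, 0, 0;
     0, -1, 0, 0, 0, 0;
     0, 0, 0, β⁻¹, 0, 0;
     0, 0, 0, 0, β + β⁻¹, 1;
     0, 0, 0, 0, -1, 0]

noncomputable def ρ₀σ₁ {F : Type*} [Field F] (α β : F) : Matrix (Fin 3) (Fin 3) F :=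
  !![α⁻¹, 0, β + β⁻¹; 0, 0, -1; 0, 1, β + β⁻¹]

noncomputable def ρ₀σ₂ {F : Type*} [Field F] (α β : F) : Matrix (Fin 3) (Fin 3) F :=
  !![0, -1, 0; 1, β + β⁻¹, 0; 0, α⁻¹ * (β + β⁻¹), α⁻¹]

/-- The matrix of the Coxeter element `σ₃σ₂σ₁`. -/
noncomputable def ρσ₃₂₁ {F : Type*} [Field F] (α β : F) : Matrix (Fin 6) (Fin 6) F :=
  !![0, 0, 0, α⁻¹ * β * (β + β⁻¹), α⁻¹ * β ^ 2 * (β + β⁻¹), α⁻¹ + α⁻¹ * β ^ 2 * (β + β⁻¹) ^ 2 - α⁻¹ * (β + β⁻¹) ^ 2;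
     β⁻¹, 0, 0, α⁻¹ * (β + β⁻¹) ^ 2, α⁻¹ * (β + β⁻¹) * ((β + β⁻¹) ^ 2 - 1), α⁻¹ * β ^ 2 * (β + β⁻¹) ^ 2 - (β + β⁻¹);
     0, 0, 0, -(α⁻¹ * (β + β⁻¹)), -(α⁻¹ * ((β + β⁻¹) ^ 2 - 1)), -(α⁻¹ * β ^ 2 * (β + β⁻¹));
     0, β⁻¹, 0, α⁻¹ * β⁻¹ * (β + β⁻¹), α⁻¹ * β⁻¹ * (β + β⁻¹) ^ 2 + β⁻¹ * (β + β⁻¹), α⁻¹ * (β + β⁻¹) ^ 2;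
     0, 0, β⁻¹, -(α⁻¹ * (β + β⁻¹)), -(α⁻¹ * (β + β⁻¹) ^ 2), β⁻¹ * (β + β⁻¹) - α⁻¹ * β * (β + β⁻¹) ^ 2;
     0, 0, 0, α⁻¹, α⁻¹ * (β + β⁻¹), α⁻¹ * β * (β + β⁻¹)]

/-- The matrix of the square of `σ₃σ₂σ₁`. -/
noncomputable def ρσ₃₂₁Sq {F : Type*} [Field F] (α β : F) : Matrix (Fin 6) (Fin 6) F :=
  !![0, α⁻¹ * (β + β⁻¹), α⁻¹ * β * (β + β⁻¹), α⁻¹ ^ 2, α⁻¹ ^ 2 * (β + β⁻¹) + α⁻¹ * (β + β⁻¹) ^ 2, α⁻¹ ^ 2 * β * (β + β⁻¹) + α⁻¹ * β * (β + β⁻¹) ^ 2;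
     0, α⁻¹ * β⁻¹ * (β + β⁻¹) ^ 2, α⁻¹ * ((β + β⁻¹) ^ 2 + β⁻¹ ^ 3 * (β + β⁻¹)), 0, α⁻¹ * ((β + β⁻¹) ^ 2 + β⁻¹ ^ 3 * (β + β⁻¹)), α⁻¹ * (β * (β + β⁻¹) ^ 2 + β⁻¹ ^ 3 * (β + β⁻¹) ^ 2 + β⁻¹);
     0, -(α⁻¹ * β⁻¹ * (β + β⁻¹)), -(α⁻¹ * (β⁻¹ ^ 3 + (β + β⁻¹))), 0, -(α⁻¹ * β⁻¹ * (β + β⁻¹) ^ 2), -(α⁻¹ * ((β + β⁻¹) ^ 2 + β⁻¹ ^ 3 * (β + β⁻¹)));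
     β⁻¹ ^ 2, α⁻¹ * β⁻¹ ^ 2 * (β + β⁻¹), α⁻¹ * β⁻¹ ^ 2 * (β + β⁻¹) ^ 2 + β⁻¹ ^ 2 * (β + β⁻¹), 0, α⁻¹ * β⁻¹ ^ 3 * (β + β⁻¹), α⁻¹ * β⁻¹ ^ 3 * (β + β⁻¹) ^ 2 + β⁻¹ ^ 3 * (β + β⁻¹);
     0, -(α⁻¹ * β⁻¹ * (β + β⁻¹)), -(α⁻¹ * β⁻¹ * (β + β⁻¹) ^ 2), 0, -(α⁻¹ * (β⁻¹ ^ 3 + (β + β⁻¹))), -(α⁻¹ * ((β + β⁻¹) ^ 2 + β⁻¹ ^ 3 * (β + β⁻¹)));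
     0, α⁻¹ * β⁻¹, α⁻¹ * β⁻¹ * (β + β⁻¹), 0, α⁻¹ * β⁻¹ * (β + β⁻¹), α⁻¹ * β⁻¹ * (β + β⁻¹) ^ 2]

set_option maxHeartbeats 1000000 in
theorem ρσ_mul_eq {F : Type*} [Field F] {α β : F} (hα : α ≠ 0) (hβ : β ≠ 0) :
    ρσ₃ α β * ρσ₂ α β * ρσ₁ α β = ρσ₃₂₁ α β := by
  ext i j
  fin_cases i <;> fin_cases j <;>
    simp [ρσ₁, ρσ₂, ρσ₃, ρσ₃₂₁, Matrix.mul_apply, Fin.sum_univ_succ, -mul_eq_mul_left_iff, -mul_eq_mul_right_iff] <;>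
    field_simp <;> ring

set_option maxHeartbeats 1000000 in
theorem ρσ₃₂₁_mul_self {F : Type*} [Field F] {α β : F} (hα : α ≠ 0) (hβ : β ≠ 0) :
    ρσ₃₂₁ α β * ρσ₃₂₁ α β = ρσ₃₂₁Sq α β := by
  ext i j
  fin_cases i <;> fin_cases j <;>
    simp [ρσ₃₂₁, ρσ₃₂₁Sq, Matrix.mul_apply, Fin.sum_univ_succ, -mul_eq_mul_left_iff, -mul_eq_mul_right_iff] <;>
    field_simp <;> ring

set_option maxHeartbeats 1000000 in
theorem ρσ₃₂₁Sq_mul_self {F : Type*} [Field F] {α β : F} (hα : α ≠ 0) (hβ : β ≠ 0) :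
    ρσ₃₂₁Sq α β * ρσ₃₂₁Sq α β = ((α * β) ^ (-2 : ℤ)) • (1 : Matrix (Fin 6) (Fin 6) F) := by
  rw [show (α * β) ^ (-2 : ℤ) = α⁻¹ ^ 2 * β⁻¹ ^ 2 by
    simp [_root_.zpow_neg, mul_pow, zpow_ofNat, mul_comm]]
  ext i j
  fin_cases i <;> fin_cases j <;>
    simp [ρσ₃₂₁Sq, Matrix.mul_apply, Fin.sum_univ_succ, -mul_eq_mul_left_iff, -mul_eq_mul_right_iff] <;>
    field_simp <;> ring

theorem ρσ_mul_pow_four {F : Type*} [Field F] {α β : F} (hα : α ≠ 0) (hβ : β ≠ 0) :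
    (ρσ₃ α β * ρσ₂ α β * ρσ₁ α β) ^ 4 =
      ((α * β) ^ (-2 : ℤ)) • (1 : Matrix (Fin 6) (Fin 6) F) := by
  rw [pow_mul _ 2 2, pow_two, pow_two, ρσ_mul_eq hα hβ, ρσ₃₂₁_mul_self hα hβ,
    ρσ₃₂₁Sq_mul_self hα hβ]

theorem ρ₀σ_mul_sq {F : Type*} [Field F] {α β : F} (hα : α ≠ 0) :
    (ρ₀σ₁ α β * ρ₀σ₂ α β * ρ₀σ₁ α β) ^ 2 =
      (α ^ (-2 : ℤ)) • (1 : Matrix (Fin 3) (Fin 3) F) := by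
  rw [pow_two, show α ^ (-2 : ℤ) = α⁻¹ ^ 2 by simp [_root_.zpow_neg, zpow_ofNat]]
  ext i j
  fin_cases i <;> fin_cases j <;>
    simp [ρ₀σ₁, ρ₀σ₂, Matrix.mul_apply, Fin.sum_univ_succ, -mul_eq_mul_left_iff, -mul_eq_mul_right_iff] <;>
    grind

theorem full_twist_four_strands_scalar {F : Type*} [Field F] (α β : F)
    (hα : α ≠ 0) (hβ : β ≠ 0) (hz : β + β⁻¹ ≠ 0) (k : ℕ) :
    (ρσ₃ α β * ρσ₂ α β * ρσ₁ α β) ^ (4 * k) =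
      ((α * β) ^ (-(2 * (k : ℤ)))) • (1 : Matrix (Fin 6) (Fin 6) F) ∧
    (ρ₀σ₁ α β * ρ₀σ₂ α β * ρ₀σ₁ α β) ^ 2 =
      (α ^ (-2 : ℤ)) • (1 : Matrix (Fin 3) (Fin 3) F) ∧
    (ρ₀σ₁ α β * ρ₀σ₂ α β * ρ₀σ₁ α β) ^ (4 * k) =
      (α ^ (-(4 * (k : ℤ)))) • (1 : Matrix (Fin 3) (Fin 3) F) := by
  refine ⟨?_, ρ₀σ_mul_sq hα, ?_⟩
  · rw [pow_mul, ρσ_mul_pow_four hα hβ, smul_pow, one_pow, ← zpow_natCast, ← _root_.zpow_mul,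
      neg_mul]
  · rw [show 4 * k = 2 * (2 * k) by ring, pow_mul, ρ₀σ_mul_sq hα, smul_pow, one_pow,
      ← zpow_natCast, ← _root_.zpow_mul]
    congr 2
    push_cast
    ring
end

section
/- For all natural numbers j, k, l, the character χ₀ of the 3-strand knot family K⁻_{j,k,l} (the closure of the braid σ₁σ₂^{−(1+2j)} ⊗ F₃^{l} ⊗ E₃^{k}, with F₃ = (σ₂σ₁)³ the full twist and E₃ = σ₁σ₂²σ₁ the Jucys–Murphy twist) is given by tr( ρ₀(σ₁) · ρ₀(σ₂)^{−(1+2j)} · (ρ₀(σ₂)·ρ₀(σ₁))^{3l} · (ρ₀(σ₁)·ρ₀(σ₂)²·ρ₀(σ₁))^{k} ) = α^{−2(k+l)−1} · Σ_{i=0}^{2k+2j+1} β^{2(k+j−i)+1} + Σ_{i=0}^{2(k+j)+1} α^{−2(k+l)+i} · ( β^{2(k+j+1)−i} + β^{−2(k+j+1)+i} + 2·Σ_{r=0}^{2(k+j)−i} β^{2(k+j−r)−i} ), where the inner sum over r is 0 whenever 2(k+j) − i < 0. -/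
/- STATEMENT 18: For all natural numbers j, k, l, the character χ₀ of the 3-strand knot
family K⁻_{j,k,l} (closure of σ₁σ₂^{−(1+2j)} ⊗ F₃^l ⊗ E₃^k) is given by
tr(ρ₀(σ₁)·ρ₀(σ₂)^{−(1+2j)}·(ρ₀(σ₂)ρ₀(σ₁))^{3l}·(ρ₀(σ₁)ρ₀(σ₂)²ρ₀(σ₁))^k)
  = α^{−2(k+l)−1}·Σ_{i=0}^{2k+2j+1} β^{2(k+j−i)+1}
    + Σ_{i=0}^{2(k+j)+1} α^{−2(k+l)+i}·(β^{2(k+j+1)−i} + β^{−2(k+j+1)+i}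
        + 2·Σ_{r=0}^{2(k+j)−i} β^{2(k+j−r)−i}). -/

open Matrix Finset

/-- The quantum integer `[n] = β ^ (n - 1) + β ^ (n - 3) + ⋯ + β ^ (1 - n)`. -/
noncomputable def quantumInt {F : Type*} [Field F] (β : F) (n : ℕ) : F :=
  ∑ r ∈ range n, β ^ ((n : ℤ) - 1 - 2 * r)

/-- The convolution of the powers of `α` with the quantum integers in `β`. -/
noncomputable def quantumConv {F : Type*} [Field F] (α β : F) (n : ℕ) : F :=
  ∑ i ∈ range n, α ^ i * quantumInt β (n - i)

section

variable {F : Type*} [Field F] {α β : F}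

lemma mul_quantumInt_succ (hβ : β ≠ 0) (n : ℕ) :
    β * quantumInt β (n + 1) = quantumInt β n + β ^ ((n : ℤ) + 1) := by
  unfold quantumInt
  rw [sum_range_succ', mul_add, mul_sum]
  congr 1
  · refine sum_congr rfl fun r _ => ?_
    rw [← zpow_one_add₀ hβ]
    congr 1
    push_cast
    ring
  · rw [← zpow_one_add₀ hβ]
    congr 1
    push_cast
    ring

lemma inv_mul_quantumInt_succ (hβ : β ≠ 0) (n : ℕ) :
    β⁻¹ * quantumInt β (n + 1) = quantumInt β n + β ^ (-((n : ℤ) + 1)) := by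
  unfold quantumInt
  rw [inv_mul_eq_iff_eq_mul₀ hβ, sum_range_succ, mul_add, mul_sum]
  congr 1
  · refine sum_congr rfl fun r _ => ?_
    rw [← zpow_one_add₀ hβ]
    congr 1
    push_cast
    ring
  · rw [← zpow_one_add₀ hβ]
    congr 1
    push_cast
    ring

lemma quantumInt_add_two (hβ : β ≠ 0) (n : ℕ) :
    quantumInt β (n + 2) = (β + β⁻¹) * quantumInt β (n + 1) - quantumInt β n := by
  have h₁ := inv_mul_quantumInt_succ hβ n
  have h₂ := inv_mul_quantumInt_succ hβ (n + 1)
  have h₃ : β * β ^ (-(((n + 1 : ℕ) : ℤ) + 1)) = β ^ (-((n : ℤ) + 1)) := by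
    rw [← zpow_one_add₀ hβ, Nat.cast_succ]
    congr 1
  rw [inv_mul_eq_iff_eq_mul₀ hβ, mul_add, h₃] at h₂
  linear_combination h₂ - h₁

lemma zpow_add_zpow_neg_add_two_mul_quantumInt (hβ : β ≠ 0) (n : ℕ) :
    β ^ ((n : ℤ) + 1) + β ^ (-((n : ℤ) + 1)) + 2 * quantumInt β n =
      (β + β⁻¹) * quantumInt β (n + 1) := by
  linear_combination -mul_quantumInt_succ hβ n - inv_mul_quantumInt_succ hβ n

@[simp] lemma quantumInt_zero : quantumInt β 0 = 0 := by simp [quantumInt]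

@[simp] lemma quantumInt_one : quantumInt β 1 = 1 := by simp [quantumInt]

@[simp] lemma quantumConv_zero : quantumConv α β 0 = 0 := by simp [quantumConv]

lemma quantumConv_succ (n : ℕ) :
    quantumConv α β (n + 1) = quantumInt β (n + 1) + α * quantumConv α β n := by
  unfold quantumConv
  rw [sum_range_succ', add_comm, mul_sum]
  simp [pow_succ', mul_assoc]

lemma quantumConv_add_two (hβ : β ≠ 0) (n : ℕ) :
    quantumConv α β (n + 2) =
      (β + β⁻¹) * quantumConv α β (n + 1) - quantumConv α β n + α ^ (n + 1) := by
  induction n with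
  | zero => simp [quantumConv_succ, quantumInt_add_two hβ 0]
  | succ n ih =>
    rw [quantumConv_succ (n + 2), quantumInt_add_two hβ (n + 1)]
    linear_combination α * ih - (β + β⁻¹) * quantumConv_succ (α := α) (β := β) (n + 1) +
      quantumConv_succ (α := α) (β := β) n

lemma inv_ρ₀σ₂ (hα : α ≠ 0) :
    (ρ₀σ₂ α β)⁻¹ = !![β + β⁻¹, 1, 0; -1, 0, 0; β + β⁻¹, 0, α] := by
  refine inv_eq_left_inv ?_
  ext i j
  fin_cases i <;> fin_cases j <;> simp [ρ₀σ₂, mul_apply, Fin.sum_univ_three, hα]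

lemma inv_ρ₀σ₂_pow_succ (hα : α ≠ 0) (hβ : β ≠ 0) (n : ℕ) :
    (ρ₀σ₂ α β)⁻¹ ^ (n + 1) =
      !![quantumInt β (n + 2), quantumInt β (n + 1), 0;
        -quantumInt β (n + 1), -quantumInt β n, 0;
        (β + β⁻¹) * quantumConv α β (n + 1), (β + β⁻¹) * quantumConv α β n, α ^ (n + 1)] := by
  induction n with
  | zero =>
    rw [inv_ρ₀σ₂ hα]
    simp [quantumConv_succ, quantumInt_add_two hβ 0]
  | succ n ih =>
    rw [pow_succ', ih, inv_ρ₀σ₂ hα, quantumConv_succ (n + 1), quantumConv_succ n,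
      quantumInt_add_two hβ (n + 1), quantumInt_add_two hβ n]
    ext i j
    fin_cases i <;> fin_cases j <;> simp [mul_apply, Fin.sum_univ_three] <;> ring

lemma trace_ρ₀σ₁_mul_inv_ρ₀σ₂_pow_succ (hα : α ≠ 0) (hβ : β ≠ 0) (n : ℕ) :
    (ρ₀σ₁ α β * (ρ₀σ₂ α β)⁻¹ ^ (n + 1)).trace =
      α⁻¹ * quantumInt β (n + 2) + (β + β⁻¹) * quantumConv α β (n + 2) := by
  rw [inv_ρ₀σ₂_pow_succ hα hβ, quantumConv_add_two hβ]
  simp [ρ₀σ₁, trace_fin_three]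
  ring

lemma ρ₀_fullTwist :
    (ρ₀σ₂ α β * ρ₀σ₁ α β) ^ 3 = (α⁻¹ ^ 2) • (1 : Matrix (Fin 3) (Fin 3) F) := by
  ext i j
  fin_cases i <;> fin_cases j <;>
    simp [ρ₀σ₁, ρ₀σ₂, pow_succ, mul_apply, Fin.sum_univ_three]

lemma ρ₀_jucysMurphy (hα : α ≠ 0) (hβ : β ≠ 0) :
    ρ₀σ₁ α β * ρ₀σ₂ α β ^ 2 * ρ₀σ₁ α β = (α⁻¹ ^ 2) • (ρ₀σ₂ α β)⁻¹ ^ 2 := by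
  rw [inv_ρ₀σ₂ hα]
  ext i j
  fin_cases i <;> fin_cases j <;>
    simp [ρ₀σ₁, ρ₀σ₂, pow_succ, mul_apply, Fin.sum_univ_three] <;> field_simp <;> ring

end

theorem chi0_Kminus_family {F : Type*} [Field F] (α β : F)
    (hα : α ≠ 0) (hβ : β ≠ 0) (hz : β + β⁻¹ ≠ 0) (j k l : ℕ) :
    (ρ₀σ₁ α β * ((ρ₀σ₂ α β)⁻¹) ^ (1 + 2 * j) *
        (ρ₀σ₂ α β * ρ₀σ₁ α β) ^ (3 * l) *
        (ρ₀σ₁ α β * ρ₀σ₂ α β ^ 2 * ρ₀σ₁ α β) ^ k).trace =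
      α ^ (-(2 * ((k : ℤ) + (l : ℤ))) - 1) *
        ∑ i ∈ Finset.range (2 * k + 2 * j + 2), β ^ (2 * ((k : ℤ) + (j : ℤ) - (i : ℤ)) + 1) +
      ∑ i ∈ Finset.range (2 * (k + j) + 2),
        α ^ (-(2 * ((k : ℤ) + (l : ℤ))) + (i : ℤ)) *
          (β ^ (2 * ((k : ℤ) + (j : ℤ) + 1) - (i : ℤ)) +
            β ^ (-(2 * ((k : ℤ) + (j : ℤ) + 1)) + (i : ℤ)) +
            2 * ∑ r ∈ Finset.range (2 * (k + j) + 1 - i),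
                β ^ (2 * ((k : ℤ) + (j : ℤ) - (r : ℤ)) - (i : ℤ))) := by
  have hpow : ρ₀σ₁ α β * ((ρ₀σ₂ α β)⁻¹) ^ (1 + 2 * j) * (ρ₀σ₂ α β * ρ₀σ₁ α β) ^ (3 * l) *
      (ρ₀σ₁ α β * ρ₀σ₂ α β ^ 2 * ρ₀σ₁ α β) ^ k =
      (α⁻¹ ^ (2 * (k + l))) • (ρ₀σ₁ α β * (ρ₀σ₂ α β)⁻¹ ^ (2 * (k + j) + 1)) := by
    rw [pow_mul (ρ₀σ₂ α β * ρ₀σ₁ α β), ρ₀_fullTwist, ρ₀_jucysMurphy hα hβ,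
      smul_pow, smul_pow, one_pow, mul_smul_comm, mul_smul_comm, mul_one, smul_mul_assoc,
      smul_smul, mul_assoc, ← pow_mul, ← pow_mul, ← pow_mul, ← pow_add, ← pow_add]
    rw [show 2 * k + 2 * l = 2 * (k + l) by ring,
      show 1 + 2 * j + 2 * k = 2 * (k + j) + 1 by ring]
  have hscal : α⁻¹ ^ (2 * (k + l)) = α ^ (-(2 * ((k : ℤ) + (l : ℤ)))) := by
    rw [_root_.zpow_neg, inv_pow, ← zpow_natCast]
    push_cast
    rfl
  have hfst : ∑ i ∈ range (2 * k + 2 * j + 2), β ^ (2 * ((k : ℤ) + (j : ℤ) - (i : ℤ)) + 1) =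
      quantumInt β (2 * (k + j) + 2) := by
    unfold quantumInt
    rw [mul_add]
    refine sum_congr rfl fun i _ => ?_
    congr 1
    push_cast
    ring
  rw [hpow, trace_smul, smul_eq_mul, trace_ρ₀σ₁_mul_inv_ρ₀σ₂_pow_succ hα hβ, hscal, hfst,
    zpow_sub_one₀ hα, mul_add, mul_assoc]
  congr 1
  rw [quantumConv, mul_sum, mul_sum]
  refine sum_congr rfl fun i hi => ?_
  obtain ⟨n, hn⟩ : ∃ n, 2 * (k + j) + 1 = n + i :=
    ⟨2 * (k + j) + 1 - i, by have := mem_range.1 hi; omega⟩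
  have hn' : 2 * ((k : ℤ) + j) + 1 = n + i := by exact_mod_cast hn
  have hinner : ∑ r ∈ range (2 * (k + j) + 1 - i),
      β ^ (2 * ((k : ℤ) + (j : ℤ) - (r : ℤ)) - (i : ℤ)) = quantumInt β n := by
    rw [hn, Nat.add_sub_cancel, quantumInt]
    refine sum_congr rfl fun r _ => ?_
    congr 1
    linear_combination hn'
  have hsub : 2 * (k + j) + 2 - i = n + 1 := by omega
  have hpos : 2 * ((k : ℤ) + j + 1) - i = n + 1 := by linear_combination hn'
  have hneg : -(2 * ((k : ℤ) + j + 1)) + i = -((n : ℤ) + 1) := by linear_combination -hn'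
  rw [hinner, hsub, hpos, hneg, zpow_add_zpow_neg_add_two_mul_quantumInt hβ,
    zpow_add₀ hα, zpow_natCast]
  ring
end
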